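/- Let G be a concurrent stochastic game with a finite state set S, sink states ⊤ and ⊥, countable Max action sets, B(s) finite for every s, and suppose ⊥ is the only state with val(Reach(⊤), ·) = 0. Let S_0 be the set of states admitting an optimal Max strategy, S_0^+ := S_0 \ {⊥}, and let σ_0 assign to each s ∈ S_0 an optimality-preserving mixed action α_s such that, with R(0) := {⊤} and R(n+1) := R(n) ∪ {s ∈ S_0 : p(s,α_s,b)(R(n)) ≥ δ_s for some δ_s > 0 and all value-preserving b ∈ B(s)}, one has S_0^+ = R(|S|−1). Then for every Max strategy σ that plays σ_0(s_h) at every history h with s_h ∈ S_0, and every Min strategy π and initial state s, P_{s,σ,π}-almost every play that eventually remains forever in S_0^+ and eventually uses only value-preserving Min actions reaches ⊤. -/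

import Mathlib

open scoped ENNReal Classical

/-- One step of a play: a state together with the actions chosen by Max and Min there. -/
structure Step (S A B : Type) where
  st : S
  ac : A
  bc : B

instance {S A B : Type} : MeasurableSpace (Step S A B) := ⊤

/-- A history: the list of past steps together with the current (final) state. -/
abbrev Hist (S A B : Type) := List (Step S A B) × S

/-- An infinite play. -/
abbrev Play (S A B : Type) := ℕ → Step S A B

/-- A concurrent stochastic game: action sets for Max and Min at each state
(nonempty; countability is imposed via `Countable` instances on `S`, `A`, `B`),
and a transition probability distribution for each state and pair of actions. -/
structure Game (S A B : Type) where
  actA : S → Set A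
  actB : S → Set B
  actA_nonempty : ∀ s, (actA s).Nonempty
  actB_nonempty : ∀ s, (actB s).Nonempty
  p : S → A → B → PMF S

namespace Game

variable {S A B : Type}

/-- A Max strategy assigns to each history a mixed action on the Max actions
available at the final state of the history. -/
def IsMaxStrategy (G : Game S A B) (σ : Hist S A B → PMF A) : Prop :=
  ∀ h : Hist S A B, (σ h).support ⊆ G.actA h.2

/-- A Min strategy assigns to each history a mixed action on the Min actions
available at the final state of the history. -/
def IsMinStrategy (G : Game S A B) (π : Hist S A B → PMF B) : Prop :=
  ∀ h : Hist S A B, (π h).support ⊆ G.actB h.2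

/-- A sink state: all transitions from it return to it with probability 1. -/
def IsSink (G : Game S A B) (s : S) : Prop := ∀ a b, G.p s a b s = 1

/-- A history is valid if all actions taken in it were available. -/
def ValidHist (G : Game S A B) (h : Hist S A B) : Prop :=
  ∀ z ∈ h.1, z.ac ∈ G.actA z.st ∧ z.bc ∈ G.actB z.st

/-- Transition function extended to a mixed Max action and a pure Min action. -/
noncomputable def pA (G : Game S A B) (s : S) (α : PMF A) (b : B) : PMF S :=
  α.bind fun a => G.p s a b

/-- Transition function extended to mixed actions of both players. -/
noncomputable def pAB (G : Game S A B) (s : S) (α : PMF A) (β : PMF B) : PMF S :=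
  α.bind fun a => β.bind fun b => G.p s a b

/-- The state reached after the current position: the state of the next listed
step, or the given final state if no steps remain. -/
def nextState : List (Step S A B) → S → S
  | [], t => t
  | z :: _, _ => z.st

/-- Auxiliary recursion computing the probability of a history:
`pre` is the already-consumed prefix, `cur` the current state, and the
remaining steps and final state are processed from the left. -/
noncomputable def histProbAux (G : Game S A B)
    (σ : Hist S A B → PMF A) (π : Hist S A B → PMF B) :
    List (Step S A B) → S → List (Step S A B) → S → ℝ≥0∞
  | _, cur, [], t => if t = cur then 1 else 0
  | pre, cur, z :: rest, t =>
    if z.st = cur then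
      σ (pre, cur) z.ac * π (pre, cur) z.bc *
        G.p z.st z.ac z.bc (nextState rest t) *
        histProbAux G σ π (pre ++ [z]) (nextState rest t) rest t
    else 0

/-- The probability of (the cylinder of) a history under strategies σ, π from
initial state `s0`. -/
noncomputable def histProb (G : Game S A B)
    (σ : Hist S A B → PMF A) (π : Hist S A B → PMF B) (s0 : S) (h : Hist S A B) : ℝ≥0∞ :=
  G.histProbAux σ π [] s0 h.1 h.2

end Game

/-- The cylinder set of plays extending a given history. -/
def cylinder {S A B : Type} (h : Hist S A B) : Set (Play S A B) :=
  {ω | (∀ i : Fin h.1.length, ω i = h.1.get i) ∧ (ω h.1.length).st = h.2}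

/-- A strategy is memoryless if its choice depends only on the final state. -/
def Memoryless {S A B X : Type} (σ : Hist S A B → X) : Prop :=
  ∀ h h' : Hist S A B, h.2 = h'.2 → σ h = σ h'

/-- The event that the play visits state `t`. -/
def Reaches {S A B : Type} (t : S) : Set (Play S A B) := {ω | ∃ i, (ω i).st = t}

/-- The event that the play never visits state `t`. -/
def Avoids {S A B : Type} (t : S) : Set (Play S A B) := {ω | ∀ i, (ω i).st ≠ t}

/-- The event that the play visits state `t` within at most `n` steps. -/
def ReachesWithin {S A B : Type} (t : S) (n : ℕ) : Set (Play S A B) :=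
  {ω | ∃ i ≤ n, (ω i).st = t}

/-- Expectation of `v : S → ℝ≥0∞` with respect to a distribution on `S`. -/
noncomputable def expE {S : Type} (μ : PMF S) (v : S → ℝ≥0∞) : ℝ≥0∞ := ∑' t, μ t * v t

/-- Expectation of a real-valued `v` with respect to a distribution on `S`. -/
noncomputable def expR {S : Type} (μ : PMF S) (v : S → ℝ) : ℝ := ∑' t, (μ t).toReal * v t

/-- The mass a distribution assigns to a set of states. -/
noncomputable def massOf {S : Type} (μ : PMF S) (T : Set S) : ℝ≥0∞ :=
  ∑' t, T.indicator (⇑μ) t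

namespace Game

variable {S A B : Type}

/-- `μ` is the probability measure on plays induced by strategies σ, π from
initial state `s0` (characterized on cylinder sets, by Carathéodory's
extension theorem). -/
def IsPlayMeasure (G : Game S A B) (σ : Hist S A B → PMF A) (π : Hist S A B → PMF B)
    (s0 : S) (μ : MeasureTheory.Measure (Play S A B)) : Prop :=
  MeasureTheory.IsProbabilityMeasure μ ∧
    ∀ h : Hist S A B, μ (cylinder h) = G.histProb σ π s0 h

/-- The (lower) value `sup_σ inf_π P_{s,σ,π}(E)` of objective `E` from state `s`,
relative to the family `P` of induced play measures. -/
noncomputable def val (G : Game S A B)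
    (P : (Hist S A B → PMF A) → (Hist S A B → PMF B) → S →
      MeasureTheory.Measure (Play S A B))
    (E : Set (Play S A B)) (s : S) : ℝ≥0∞ :=
  ⨆ σ ∈ {σ | G.IsMaxStrategy σ}, ⨅ π ∈ {π | G.IsMinStrategy π}, P σ π s E

/-- The set of states from which Max has an optimal strategy for `Reaches top`. -/
def OptStates (G : Game S A B)
    (P : (Hist S A B → PMF A) → (Hist S A B → PMF B) → S →
      MeasureTheory.Measure (Play S A B))
    (top : S) : Set S :=
  {s | ∃ σ, G.IsMaxStrategy σ ∧ ∀ π, G.IsMinStrategy π →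
      P σ π s (Reaches top) ≥ G.val P (Reaches top) s}

/-- A mixed Max action `α` at `s` is optimality-preserving if every Min action
gives expected value at least the value of `s`, and in case of equality the
successor distribution is supported on states admitting optimal strategies. -/
def OptPreserving (G : Game S A B)
    (P : (Hist S A B → PMF A) → (Hist S A B → PMF B) → S →
      MeasureTheory.Measure (Play S A B))
    (top : S) (s : S) (α : PMF A) : Prop :=
  ∀ b ∈ G.actB s,
    G.val P (Reaches top) s ≤ expE (G.pA s α b) (G.val P (Reaches top)) ∧
    (expE (G.pA s α b) (G.val P (Reaches top)) = G.val P (Reaches top) s →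
      (G.pA s α b).support ⊆ G.OptStates P top)

/-- A Min action `b` is value-preserving at `s` against the mixed action `α`. -/
def ValuePres (G : Game S A B)
    (P : (Hist S A B → PMF A) → (Hist S A B → PMF B) → S →
      MeasureTheory.Measure (Play S A B))
    (top : S) (s : S) (α : PMF A) (b : B) : Prop :=
  expE (G.pA s α b) (G.val P (Reaches top)) = G.val P (Reaches top) s

end Game

namespace Game

variable {S A B : Type}

/-- The probability of a history splits off its last step. -/
theorem histProbAux_append (G : Game S A B) (σ : Hist S A B → PMF A) (π : Hist S A B → PMF B)
    (l : List (Step S A B)) (z : Step S A B) (t : S) (pre : List (Step S A B)) (cur : S) :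
    G.histProbAux σ π pre cur (l ++ [z]) t =
      G.histProbAux σ π pre cur l z.st *
        (σ (pre ++ l, z.st) z.ac * π (pre ++ l, z.st) z.bc * G.p z.st z.ac z.bc t) := by
  induction l generalizing pre cur with
  | nil =>
    by_cases h : z.st = cur
    · subst h; simp [histProbAux, nextState]
    · simp [histProbAux, h]
  | cons y l ih =>
    have hn : nextState (l ++ [z]) t = nextState l z.st := by cases l <;> rfl
    simp only [List.cons_append, histProbAux, hn, ih]
    split_ifs
    · simp [mul_assoc]
    · simp

/-- Every step of `l` from position `N` on satisfies `good`. -/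
def TailGood (good : S → B → Prop) (N : ℕ) (l : List (Step S A B)) : Prop :=
  ∀ i, ∀ hi : i < l.length, N ≤ i → good l[i].st l[i].bc

theorem tailGood_append {good : S → B → Prop} {N : ℕ} {l : List (Step S A B)} {z : Step S A B}
    (hN : N ≤ l.length) :
    TailGood good N (l ++ [z]) ↔ TailGood good N l ∧ good z.st z.bc := by
  constructor
  · intro h
    refine ⟨fun i hi hNi => ?_, ?_⟩
    · have := h i (by simp; omega) hNi
      rwa [List.getElem_append_left hi] at this
    · simpa using h l.length (by simp) hN
  · rintro ⟨h, hz⟩ i hi hNi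
    rcases Nat.lt_or_ge i l.length with h' | h'
    · rw [List.getElem_append_left h']; exact h i h' hNi
    · have : i = l.length := by simp at hi; omega
      subst this
      simpa using hz

/-- Expected value of `f` at time `k` on the event that all steps at times in `[N, k)` are good. -/
noncomputable def tailWeight (G : Game S A B) (σ : Hist S A B → PMF A) (π : Hist S A B → PMF B)
    (s0 : S) (good : S → B → Prop) (f : S → ℝ≥0∞) (N k : ℕ) : ℝ≥0∞ :=
  ∑' l : List (Step S A B), ∑' t : S,
    if l.length = k ∧ TailGood good N l then G.histProb σ π s0 (l, t) * f t else 0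

theorem tsum_list_eq_tsum_append {X : Type} (F : List X → ℝ≥0∞) (h : F [] = 0) :
    ∑' l, F l = ∑' l, ∑' z, F (l ++ [z]) := by
  rw [← ENNReal.tsum_prod (f := fun l z => F (l ++ [z]))]
  have hinj : Function.Injective (fun q : List X × X => q.1 ++ [q.2]) := by
    rintro ⟨l, z⟩ ⟨l', z'⟩ hq
    simpa using hq
  refine (hinj.tsum_eq (f := F) ?_).symm
  intro l hl
  rcases List.eq_nil_or_concat l with rfl | ⟨l', z, rfl⟩
  · exact absurd h hl
  · exact ⟨(l', z), by simp⟩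

/-- Steps as triples. -/
def stepEquiv : S × B × A ≃ Step S A B where
  toFun q := ⟨q.1, q.2.2, q.2.1⟩
  invFun z := (z.st, z.bc, z.ac)
  left_inv _ := rfl
  right_inv _ := rfl

theorem tsum_step (F : Step S A B → ℝ≥0∞) :
    ∑' z, F z = ∑' s, ∑' b, ∑' a, F ⟨s, a, b⟩ := by
  rw [← stepEquiv.tsum_eq F, ENNReal.tsum_prod']
  refine tsum_congr fun s => ?_
  rw [ENNReal.tsum_prod']
  rfl

theorem expE_pA (G : Game S A B) (s : S) (α : PMF A) (b : B) (f : S → ℝ≥0∞) :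
    expE (G.pA s α b) f = ∑' a, α a * ∑' t, G.p s a b t * f t := by
  simp only [expE, pA, PMF.bind_apply, ← ENNReal.tsum_mul_right, ← ENNReal.tsum_mul_left]
  rw [ENNReal.tsum_comm]
  simp only [mul_assoc]

theorem tailWeight_succ_le (G : Game S A B) {σ : Hist S A B → PMF A} {π : Hist S A B → PMF B}
    (hπ : G.IsMinStrategy π) (s0 : S) {good : S → B → Prop} {f : S → ℝ≥0∞} {r : ℝ≥0∞}
    (σ0 : S → PMF A) (hσ : ∀ h : Hist S A B, ∀ b, good h.2 b → σ h = σ0 h.2)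
    (hf : ∀ s b, good s b → b ∈ G.actB s → expE (G.pA s (σ0 s) b) f ≤ r * f s)
    {N k : ℕ} (hN : N ≤ k) :
    G.tailWeight σ π s0 good f N (k + 1) ≤ r * G.tailWeight σ π s0 good f N k := by
  unfold tailWeight
  rw [tsum_list_eq_tsum_append _ (by simp), ← ENNReal.tsum_mul_left]
  refine ENNReal.tsum_le_tsum fun l => ?_
  rw [tsum_step, ← ENNReal.tsum_mul_left]
  refine ENNReal.tsum_le_tsum fun s => ?_
  by_cases hl : l.length = k ∧ TailGood good N l
  swap
  · have : ∀ z : Step S A B, ¬ ((l ++ [z]).length = k + 1 ∧ TailGood good N (l ++ [z])) := by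
      rintro z ⟨h1, h2⟩
      have hlen : l.length = k := by simpa using h1
      exact hl ⟨hlen, ((tailGood_append (by omega)).1 h2).1⟩
    simp only [this, if_false, tsum_zero, zero_le]
  rw [if_pos hl]
  have hbd : ∀ b, (∑' a, ∑' t,
      if (l ++ [(⟨s, a, b⟩ : Step S A B)]).length = k + 1 ∧
          TailGood good N (l ++ [(⟨s, a, b⟩ : Step S A B)]) then
        G.histProb σ π s0 (l ++ [⟨s, a, b⟩], t) * f t else 0) ≤
      π (l, s) b * (G.histProb σ π s0 (l, s) * (r * f s)) := by
    intro b
    by_cases hg : good s b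
    swap
    · have : ∀ a, ¬ TailGood good N (l ++ [(⟨s, a, b⟩ : Step S A B)]) := fun a h =>
        hg ((tailGood_append (by omega)).1 h).2
      simp [this]
    have hg' : ∀ a, TailGood good N (l ++ [(⟨s, a, b⟩ : Step S A B)]) := fun a =>
      (tailGood_append (by omega)).2 ⟨hl.2, hg⟩
    by_cases hb : π (l, s) b = 0
    · simp [histProb, histProbAux_append, hb]
    have hb' : b ∈ G.actB s := hπ (l, s) ((PMF.mem_support_iff _ _).2 hb)
    calc _ = ∑' a, ∑' t, π (l, s) b * (G.histProb σ π s0 (l, s) *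
            (σ0 s a * (G.p s a b t * f t))) := by
          refine tsum_congr fun a => tsum_congr fun t => ?_
          rw [if_pos ⟨by simp [hl.1], hg' a⟩]
          simp only [histProb, histProbAux_append, List.nil_append]
          rw [hσ (l, s) b hg]
          ring
      _ = π (l, s) b * (G.histProb σ π s0 (l, s) * expE (G.pA s (σ0 s) b) f) := by
          simp only [ENNReal.tsum_mul_left, expE_pA]
      _ ≤ _ := by
          gcongr
          exact hf s b hg hb'
  refine (ENNReal.tsum_le_tsum hbd).trans ?_
  rw [ENNReal.tsum_mul_right, PMF.tsum_coe, one_mul, mul_left_comm]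

theorem tailWeight_add_le (G : Game S A B) {σ : Hist S A B → PMF A} {π : Hist S A B → PMF B}
    (hπ : G.IsMinStrategy π) (s0 : S) {good : S → B → Prop} {f : S → ℝ≥0∞} {r : ℝ≥0∞}
    (σ0 : S → PMF A) (hσ : ∀ h : Hist S A B, ∀ b, good h.2 b → σ h = σ0 h.2)
    (hf : ∀ s b, good s b → b ∈ G.actB s → expE (G.pA s (σ0 s) b) f ≤ r * f s) (N n : ℕ) :
    G.tailWeight σ π s0 good f N (N + n) ≤ r ^ n * G.tailWeight σ π s0 good f N N := by
  induction n with
  | zero => simp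
  | succ n ih =>
    calc _ ≤ r * G.tailWeight σ π s0 good f N (N + n) :=
          G.tailWeight_succ_le hπ s0 σ0 hσ hf (Nat.le_add_right N n)
      _ ≤ r * (r ^ n * G.tailWeight σ π s0 good f N N) := by gcongr
      _ = _ := by ring

theorem measurableSet_cylinder (h : Hist S A B) : MeasurableSet (cylinder h) := by
  have : cylinder h = (⋂ i : Fin h.1.length, (fun ω : Play S A B => ω i) ⁻¹' {h.1.get i}) ∩
      (fun ω : Play S A B => ω h.1.length) ⁻¹' {z | z.st = h.2} := by
    ext ω
    simp [cylinder]
  rw [this]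
  have htop : ∀ s : Set (Step S A B), MeasurableSet s := fun _ => trivial
  exact (MeasurableSet.iInter fun i : Fin h.1.length =>
    measurable_pi_apply (i : ℕ) (htop _)).inter (measurable_pi_apply h.1.length (htop _))

theorem eq_of_mem_cylinder {ω : Play S A B} {h : Hist S A B} (hω : ω ∈ cylinder h) :
    h = (List.ofFn fun i : Fin h.1.length => ω i, (ω h.1.length).st) := by
  refine Prod.ext ?_ hω.2.symm
  refine List.ext_get (by simp) fun i hi _ => ?_
  simpa using (hω.1 ⟨i, hi⟩).symm

instance [Finite S] [Countable A] [Countable B] : Countable (Step S A B) :=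
  stepEquiv.symm.injective.countable

theorem tailWeight_le_one [Finite S] [Countable A] [Countable B]
    (G : Game S A B) {σ : Hist S A B → PMF A} {π : Hist S A B → PMF B}
    {s0 : S} {μ : MeasureTheory.Measure (Play S A B)} (hμ : G.IsPlayMeasure σ π s0 μ)
    (good : S → B → Prop) {f : S → ℝ≥0∞} (hf : ∀ s, f s ≤ 1) (N k : ℕ) :
    G.tailWeight σ π s0 good f N k ≤ 1 := by
  have := hμ.1
  unfold tailWeight
  rw [← ENNReal.tsum_prod (f := fun (l : List (Step S A B)) (t : S) =>
    if l.length = k ∧ TailGood good N l then G.histProb σ π s0 (l, t) * f t else 0)]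
  set C : Hist S A B → Set (Play S A B) := fun h => if h.1.length = k then cylinder h else ∅
  have hC : ∀ h, MeasurableSet (C h) := by
    intro h
    simp only [C]
    split_ifs
    · exact measurableSet_cylinder h
    · exact MeasurableSet.empty
  have hdisj : Pairwise (Function.onFun Disjoint C) := by
    intro h h' hne
    refine Set.disjoint_left.2 fun ω hω hω' => hne ?_
    simp only [C] at hω hω'
    split_ifs at hω hω' with hk hk'
    any_goals exact absurd ‹_› (Set.notMem_empty _)
    rw [eq_of_mem_cylinder hω, eq_of_mem_cylinder hω', hk, hk']
  calc _ ≤ ∑' h, μ (C h) := by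
        refine ENNReal.tsum_le_tsum fun h => ?_
        split_ifs with hh
        · simp only [C, if_pos hh.1, hμ.2 h]
          exact mul_le_of_le_one_right' (hf _)
        · exact zero_le
    _ = μ (⋃ h, C h) := (MeasureTheory.measure_iUnion hdisj hC).symm
    _ ≤ 1 := MeasureTheory.prob_le_one

/-- A potential contracted by every good step forces almost every play to leave the good steps. -/
theorem measure_tail_good_eq_zero [Finite S] [Countable A] [Countable B]
    (G : Game S A B) {σ : Hist S A B → PMF A} {π : Hist S A B → PMF B}
    (hπ : G.IsMinStrategy π) {s0 : S} {μ : MeasureTheory.Measure (Play S A B)}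
    (hμ : G.IsPlayMeasure σ π s0 μ) {good : S → B → Prop} {f : S → ℝ≥0∞} {r c : ℝ≥0∞}
    (σ0 : S → PMF A) (hσ : ∀ h : Hist S A B, ∀ b, good h.2 b → σ h = σ0 h.2)
    (hf : ∀ s b, good s b → b ∈ G.actB s → expE (G.pA s (σ0 s) b) f ≤ r * f s)
    (hf1 : ∀ s, f s ≤ 1) (hr : r < 1) (hc : c ≠ 0) (hcf : ∀ s b, good s b → c ≤ f s) (N : ℕ) :
    μ {ω | ∀ i ≥ N, good (ω i).st (ω i).bc} = 0 := by
  set E : Set (Play S A B) := {ω | ∀ i ≥ N, good (ω i).st (ω i).bc}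
  have key : ∀ n, c * μ E ≤ r ^ n := by
    intro n
    set C : Hist S A B → Set (Play S A B) := fun h =>
      if h.1.length = N + n ∧ TailGood good N h.1 ∧ c ≤ f h.2 then cylinder h else ∅
    have hsub : E ⊆ ⋃ h, C h := by
      intro ω hω
      refine Set.mem_iUnion.2
        ⟨(List.ofFn fun i : Fin (N + n) => ω i, (ω (N + n)).st), ?_⟩
      have hcond : (List.ofFn fun i : Fin (N + n) => ω i).length = N + n ∧
          TailGood good N (List.ofFn fun i : Fin (N + n) => ω i) ∧ c ≤ f (ω (N + n)).st := by
        refine ⟨by simp, fun i hi hNi => ?_, hcf _ _ (hω (N + n) (by omega))⟩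
        simpa using hω i hNi
      simp only [C]
      rw [if_pos hcond]
      refine ⟨fun i => by simp, by simp⟩
    calc c * μ E ≤ c * ∑' h, μ (C h) := by
          gcongr
          exact (MeasureTheory.measure_mono hsub).trans (MeasureTheory.measure_iUnion_le _)
      _ = ∑' h, c * μ (C h) := ENNReal.tsum_mul_left.symm
      _ ≤ ∑' h : Hist S A B, (if h.1.length = N + n ∧ TailGood good N h.1 then
            G.histProb σ π s0 h * f h.2 else 0) := by
          refine ENNReal.tsum_le_tsum fun h => ?_
          by_cases hh : h.1.length = N + n ∧ TailGood good N h.1 ∧ c ≤ f h.2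
          · simp only [C]
            rw [if_pos hh, if_pos ⟨hh.1, hh.2.1⟩, hμ.2 h, mul_comm]
            gcongr
            exact hh.2.2
          · simp only [C]
            rw [if_neg hh]
            simp
      _ = G.tailWeight σ π s0 good f N (N + n) := by
          rw [ENNReal.tsum_prod', tailWeight]
      _ ≤ r ^ n * G.tailWeight σ π s0 good f N N := G.tailWeight_add_le hπ s0 σ0 hσ hf N n
      _ ≤ r ^ n := mul_le_of_le_one_right' (G.tailWeight_le_one hμ good hf1 N N)
  have h0 : c * μ E ≤ 0 :=
    ge_of_tendsto' (ENNReal.tendsto_pow_atTop_nhds_zero_of_lt_one hr) key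
  exact (mul_eq_zero.1 (le_antisymm h0 zero_le)).resolve_left hc

end Game

theorem expE_add_mul_massOf_le_one {S : Type} (μ : PMF S) {f : S → ℝ≥0∞} {T : Set S} {x : ℝ≥0∞}
    (hf : ∀ t, f t ≤ 1) (hfT : ∀ t ∈ T, f t + x ≤ 1) : expE μ f + x * massOf μ T ≤ 1 := by
  rw [expE, massOf, ← ENNReal.tsum_mul_left, ← ENNReal.tsum_add, ← μ.tsum_coe]
  refine ENNReal.tsum_le_tsum fun t => ?_
  by_cases ht : t ∈ T
  · rw [Set.indicator_of_mem ht, mul_comm x, ← mul_add]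
    exact mul_le_of_le_one_right' (hfT t ht)
  · rw [Set.indicator_of_notMem ht, mul_zero, add_zero]
    exact mul_le_of_le_one_right' (hf t)

/-- A layered family of sets whose layers are each entered from the next one with uniformly
positive probability carries a strictly contracted potential. -/
theorem exists_contracted_potential {S X : Type} [Finite S] (R : ℕ → Set S) (top : S)
    (hR0 : R 0 = {top}) (m : ℕ) (q : S → X → Prop) (ν : S → X → PMF S)
    (hR : ∀ n s, s ∈ R (n + 1) → s ∉ R n →
      ∃ δ : ℝ≥0∞, 0 < δ ∧ ∀ b, q s b → δ ≤ massOf (ν s b) (R n)) :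
    ∃ (f : S → ℝ≥0∞) (r c : ℝ≥0∞), r < 1 ∧ c ≠ 0 ∧ (∀ s, f s ≤ 1) ∧
      ∀ s ∈ R m, s ≠ top → c ≤ f s ∧ ∀ b, q s b → expE (ν s b) f ≤ r * f s := by
  set rk : S → ℕ := fun s => sInf {n | s ∈ R n}
  have hrk_le : ∀ {s n}, s ∈ R n → rk s ≤ n := fun h => Nat.sInf_le h
  have hrk : ∀ s ∈ R m, s ≠ top → ∃ k, rk s = k + 1 ∧ s ∈ R (k + 1) ∧ s ∉ R k := by
    intro s hs hst
    have hmem : s ∈ R (rk s) := Nat.sInf_mem (s := {n | s ∈ R n}) ⟨m, hs⟩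
    rcases hk : rk s with _ | k
    · rw [hk, hR0] at hmem; exact absurd hmem hst
    · refine ⟨k, rfl, hk ▸ hmem, fun h => ?_⟩
      have := hrk_le h
      omega
  have hd : ∀ s, ∃ d : ℝ, 0 < d ∧ d ≤ 1 ∧ (s ∈ R m → s ≠ top → ∀ b, q s b →
      ENNReal.ofReal d ≤ massOf (ν s b) (R (rk s - 1))) := by
    intro s
    by_cases hs : s ∈ R m ∧ s ≠ top
    · obtain ⟨k, hk, h1, h2⟩ := hrk s hs.1 hs.2
      obtain ⟨δ, hδ, h⟩ := hR k s h1 h2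
      have hfin : min δ 1 ≠ ⊤ := ne_top_of_le_ne_top ENNReal.one_ne_top (min_le_right _ _)
      refine ⟨(min δ 1).toReal, ENNReal.toReal_pos (by positivity) hfin, ?_, fun _ _ b hb => ?_⟩
      · exact ENNReal.toReal_le_of_le_ofReal zero_le_one (by simp)
      · rw [ENNReal.ofReal_toReal hfin, hk]
        exact (min_le_left _ _).trans (h b hb)
    · exact ⟨1, one_pos, le_rfl, fun h1 h2 => absurd ⟨h1, h2⟩ hs⟩
  choose D hD0 hD1 hD using hd
  have : Nonempty S := ⟨top⟩
  obtain ⟨s₁, hs₁⟩ := Finite.exists_min D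
  set e : ℝ := D s₁ / 2 with he
  have he0 : 0 < e := by have := hD0 s₁; positivity
  have he1 : e < 1 := by have := hD1 s₁; linarith
  set F : S → ℝ := fun s => 1 - e ^ rk s
  refine ⟨fun s => ENNReal.ofReal (F s), ENNReal.ofReal (1 - e ^ m), ENNReal.ofReal (1 - e),
    ?_, ?_, ?_, ?_⟩
  · have : 0 < e ^ m := by positivity
    exact ENNReal.ofReal_lt_one.2 (by linarith)
  · exact (ENNReal.ofReal_pos.2 (by linarith)).ne'
  · intro s
    have : 0 < e ^ rk s := by positivity
    exact ENNReal.ofReal_le_one.2 (by simp only [F]; linarith)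
  intro s hs hst
  obtain ⟨k, hk, h1, h2⟩ := hrk s hs hst
  have hkm : k + 1 ≤ m := hk ▸ hrk_le hs
  refine ⟨ENNReal.ofReal_le_ofReal ?_, fun b hb => ?_⟩
  · have : e ^ (k + 1) ≤ e := pow_le_of_le_one he0.le he1.le (by omega)
    simp only [F, hk]; linarith
  have hmass : ENNReal.ofReal (D s₁) ≤ massOf (ν s b) (R k) := by
    have := hD s hs hst b hb
    rw [hk] at this
    exact (ENNReal.ofReal_le_ofReal (hs₁ s)).trans this
  have hle := expE_add_mul_massOf_le_one (ν s b) (f := fun s => ENNReal.ofReal (F s)) (T := R k)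
    (x := ENNReal.ofReal (e ^ k))
    (fun t => ENNReal.ofReal_le_one.2 (by
      have : 0 < e ^ rk t := by positivity
      simp only [F]; linarith))
    (fun t ht => by
      have h3 : e ^ k ≤ e ^ rk t := pow_le_pow_of_le_one he0.le he1.le (hrk_le ht)
      have h4 : e ^ rk t ≤ 1 := pow_le_one₀ he0.le he1.le
      rw [← ENNReal.ofReal_add (by simp only [F]; linarith) (by positivity)]
      exact ENNReal.ofReal_le_one.2 (by simp only [F]; linarith))
  have hek : e ^ m ≤ e ^ (k + 1) := pow_le_pow_of_le_one he0.le he1.le hkm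
  have hek1 : e ^ (k + 1) ≤ 1 := pow_le_one₀ he0.le he1.le
  have hprod : e ^ k * D s₁ = 2 * e ^ (k + 1) := by rw [he]; ring
  calc expE (ν s b) (fun s => ENNReal.ofReal (F s))
      ≤ 1 - ENNReal.ofReal (e ^ k) * ENNReal.ofReal (D s₁) := by
        refine ENNReal.le_sub_of_add_le_right (by finiteness) (le_trans ?_ hle)
        gcongr
    _ = ENNReal.ofReal (1 - 2 * e ^ (k + 1)) := by
        rw [← ENNReal.ofReal_mul (by positivity), hprod, ENNReal.ofReal_sub _ (by positivity),
          ENNReal.ofReal_one]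
    _ ≤ ENNReal.ofReal (1 - e ^ m) * ENNReal.ofReal (F s) := by
        rw [← ENNReal.ofReal_mul (by linarith)]
        refine ENNReal.ofReal_le_ofReal ?_
        simp only [F, hk]
        have : 0 ≤ e ^ m * e ^ (k + 1) := by positivity
        nlinarith

/-- Lemma 5: fixing on S₀ a memoryless choice σ₀ of
optimality-preserving mixed actions witnessing R(|S|-1) = S₀⁺, under any Max
strategy agreeing with σ₀ on S₀ and any Min strategy, almost every play that
eventually remains in S₀⁺ and eventually uses only value-preserving Min
actions reaches ⊤. -/
theorem stmt18 {S A B : Type} [Finite S] [Countable A] [Countable B]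
    (G : Game S A B) (top bot : S) (htop : G.IsSink top) (hbot : G.IsSink bot)
    (hB : ∀ s, (G.actB s).Finite)
    (P : (Hist S A B → PMF A) → (Hist S A B → PMF B) → S →
      MeasureTheory.Measure (Play S A B))
    (hP : ∀ σ π s, G.IsMaxStrategy σ → G.IsMinStrategy π →
      G.IsPlayMeasure σ π s (P σ π s))
    (hzero : ∀ s : S, G.val P (Reaches top) s = 0 ↔ s = bot)
    (σ0 : S → PMF A)
    (hσ0A : ∀ s ∈ G.OptStates P top, (σ0 s).support ⊆ G.actA s)
    (hσ0opt : ∀ s ∈ G.OptStates P top, G.OptPreserving P top s (σ0 s))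
    (R : ℕ → Set S) (hR0 : R 0 = {top})
    (hRsucc : ∀ n, R (n+1) = R n ∪ {s ∈ G.OptStates P top |
      ∃ δ : ℝ≥0∞, 0 < δ ∧ ∀ b ∈ G.actB s,
        G.ValuePres P top s (σ0 s) b → δ ≤ massOf (G.pA s (σ0 s) b) (R n)})
    (hReq : R (Nat.card S - 1) = G.OptStates P top \ {bot})
    (σ : Hist S A B → PMF A) (hσ : G.IsMaxStrategy σ)
    (hσσ0 : ∀ h : Hist S A B, h.2 ∈ G.OptStates P top → σ h = σ0 h.2)
    (π : Hist S A B → PMF B) (hπ : G.IsMinStrategy π) (s : S) :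
    P σ π s ({ω : Play S A B | ∃ N : ℕ, ∀ i ≥ N,
        (ω i).st ∈ G.OptStates P top \ {bot} ∧
        G.ValuePres P top ((ω i).st) (σ0 ((ω i).st)) ((ω i).bc)} \ Reaches top)
      = 0 := by
  have hstep : ∀ n t, t ∈ R (n + 1) → t ∉ R n → ∃ δ : ℝ≥0∞, 0 < δ ∧
      ∀ b, (b ∈ G.actB t ∧ G.ValuePres P top t (σ0 t) b) →
        δ ≤ massOf (G.pA t (σ0 t) b) (R n) := by
    intro n t ht htn
    rw [hRsucc n] at ht
    obtain ⟨-, δ, hδ, h⟩ := ht.resolve_left htn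
    exact ⟨δ, hδ, fun b hb => h b hb.1 hb.2⟩
  obtain ⟨f, r, c, hr, hc, hf1, hf⟩ := exists_contracted_potential R top hR0 (Nat.card S - 1)
    (fun t b => b ∈ G.actB t ∧ G.ValuePres P top t (σ0 t) b)
    (fun t b => G.pA t (σ0 t) b) hstep
  rw [hReq] at hf
  set good : S → B → Prop := fun t b =>
    t ∈ G.OptStates P top \ {bot} ∧ G.ValuePres P top t (σ0 t) b ∧ t ≠ top
  refine MeasureTheory.measure_mono_null (t := ⋃ N : ℕ,
    {ω : Play S A B | ∀ i ≥ N, good (ω i).st (ω i).bc}) ?_ ?_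
  · rintro ω ⟨⟨N, hN⟩, hω⟩
    exact Set.mem_iUnion.2
      ⟨N, fun i hi => ⟨(hN i hi).1, (hN i hi).2, fun h => hω ⟨i, h⟩⟩⟩
  · refine MeasureTheory.measure_iUnion_null fun N => ?_
    exact G.measure_tail_good_eq_zero hπ (hP σ π s hσ hπ) σ0
      (fun h b hg => hσσ0 h hg.1.1)
      (fun t b hg hb => (hf t hg.1 hg.2.2).2 b ⟨hb, hg.2.1⟩) hf1 hr hc
      (fun t b hg => (hf t hg.1 hg.2.2).1) N
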